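/- Let h be the function on (0,π)² given by the series h(x,y) = (4/π)·Σ_{k=0}^∞ (sin((2k+1)x)/(2k+1))·(F_{2k+1}(y) − coth((2k+1)π)·G_{2k+1}(y)). Then for all (x,y) ∈ (0,π)², h(x,y) + h(y,x) = 1. In particular h(π/4, π/4) = 1/2. -/

import Mathlib

open Real Filter Set Topology

/-- Hyperbolic cotangent. -/
noncomputable def coth (t : ℝ) : ℝ := Real.cosh t / Real.sinh t

/-- `F n y = cosh (n y) + cosh (n (π − y))`. -/
noncomputable def F (n y : ℝ) : ℝ := Real.cosh (n * y) + Real.cosh (n * (π - y))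

/-- `G n y = sinh (n y) + sinh (n (π − y))`. -/
noncomputable def G (n y : ℝ) : ℝ := Real.sinh (n * y) + Real.sinh (n * (π - y))

/-- The harmonic function `h` on `(0,π)²` given by its Fourier series. -/
noncomputable def h (x y : ℝ) : ℝ :=
  (4 / π) * ∑' k : ℕ, (Real.sin ((2 * k + 1) * x) / (2 * k + 1)) *
    (F (2 * k + 1) y - coth ((2 * k + 1) * π) * G (2 * k + 1) y)

/-- Partial derivative of `h` in its first variable. -/
noncomputable def hx (x y : ℝ) : ℝ := deriv (fun x' => h x' y) x


lemma fc_aux (b : ℝ) (n : ℤ) (hn : n ≠ 0) :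
    fourierCoeffOn zero_lt_one (fun t : ℝ => ((Real.cosh (b * (1/2 - t)) : ℝ) : ℂ)) n =
      ((2 * b * Real.sinh (b / 2) / (4 * π ^ 2 * n ^ 2 + b ^ 2) : ℝ) : ℂ) := by
  have hd1 : ∀ t : ℝ, HasDerivAt (fun t : ℝ => ((Real.cosh (b * (1/2 - t)) : ℝ) : ℂ))
      ((-b * Real.sinh (b * (1/2 - t)) : ℝ) : ℂ) t := by
    intro t
    apply HasDerivAt.ofReal_comp
    have h1 : HasDerivAt (fun t : ℝ => b * (1/2 - t)) (b * (-1)) t :=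
      ((hasDerivAt_id t).const_sub (1/2)).const_mul b
    convert! h1.cosh using 1
    ring
  have hd2 : ∀ t : ℝ, HasDerivAt (fun t : ℝ => ((-b * Real.sinh (b * (1/2 - t)) : ℝ) : ℂ))
      ((b ^ 2 : ℂ) * (Real.cosh (b * (1/2 - t)) : ℝ)) t := by
    intro t
    have h1 : HasDerivAt (fun t : ℝ => b * (1/2 - t)) (b * (-1)) t :=
      ((hasDerivAt_id t).const_sub (1/2)).const_mul b
    have h2 := (h1.sinh.const_mul (-b)).ofReal_comp
    convert! h2 using 1
    push_cast
    ring
  have e1 := fourierCoeffOn_of_hasDerivAt zero_lt_one hn (fun t _ => hd1 t)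
    (Continuous.intervalIntegrable (by fun_prop) _ _)
  have e2 := fourierCoeffOn_of_hasDerivAt zero_lt_one hn (fun t _ => hd2 t)
    (Continuous.intervalIntegrable (by fun_prop) _ _)
  rw [fourierCoeffOn.const_mul] at e2
  rw [e2] at e1
  have hn' : (n : ℂ) ≠ 0 := by exact_mod_cast hn
  have hpi : (π : ℂ) ≠ 0 := by exact_mod_cast Real.pi_ne_zero
  generalize fourierCoeffOn zero_lt_one (fun t : ℝ => ((Real.cosh (b * (1/2 - t)) : ℝ) : ℂ)) n = c at *
  have hs1 : Real.sinh (b * (1/2 - 1)) = - Real.sinh (b / 2) := by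
    rw [← Real.sinh_neg]; congr 1; ring
  have hs0 : Real.sinh (b * (1/2 - 0)) = Real.sinh (b / 2) := by congr 1; ring
  have hc1 : Real.cosh (b * (1/2 - 1)) = Real.cosh (b / 2) := by
    rw [← Real.cosh_neg]; congr 1; ring
  have hc0 : Real.cosh (b * (1/2 - 0)) = Real.cosh (b / 2) := by congr 1; ring
  rw [hs1, hs0, hc1, hc0] at e1
  have f0 : (fourier (-n)) ((0:ℝ) : AddCircle ((1:ℝ) - 0)) = 1 := by
    simp
  rw [f0] at e1
  have hpos : (4 * π ^ 2 * n ^ 2 + b ^ 2 : ℝ) ≠ 0 := by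
    have : (n : ℝ) ≠ 0 := by exact_mod_cast hn
    positivity
  have hposC : (4 * π ^ 2 * n ^ 2 + b ^ 2 : ℂ) ≠ 0 := by exact_mod_cast hpos
  push_cast at e1 ⊢
  rw [eq_div_iff hposC]
  have hI := Complex.I_sq
  have hI0 := Complex.I_ne_zero
  field_simp at e1
  rw [hI] at e1
  linear_combination (-1 : ℂ) * e1

lemma fourier_half_odd (k : ℤ) (t : ℝ) :
    fourier (2 * k + 1) ((t + 1/2 : ℝ) : AddCircle (1:ℝ)) =
      - fourier (2 * k + 1) (t : AddCircle (1:ℝ)) := by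
  rw [fourier_coe_apply, fourier_coe_apply]
  have : (2 * π * Complex.I * ((2 * k + 1 : ℤ) : ℂ) * ((t + 1/2 : ℝ) : ℂ) / ((1:ℝ) : ℂ)) =
    (2 * π * Complex.I * ((2 * k + 1 : ℤ) : ℂ) * (t : ℂ) / ((1:ℝ) : ℂ)) + k * (2 * π * Complex.I)
      + π * Complex.I := by
    push_cast; ring
  rw [this, Complex.exp_add, Complex.exp_add, Complex.exp_int_mul_two_pi_mul_I, Complex.exp_pi_mul_I]
  ring

lemma fourier_half_even (k : ℤ) (t : ℝ) :
    fourier (2 * k) ((t + 1/2 : ℝ) : AddCircle (1:ℝ)) =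
      fourier (2 * k) (t : AddCircle (1:ℝ)) := by
  rw [fourier_coe_apply, fourier_coe_apply]
  have : (2 * π * Complex.I * ((2 * k : ℤ) : ℂ) * ((t + 1/2 : ℝ) : ℂ) / ((1:ℝ) : ℂ)) =
    (2 * π * Complex.I * ((2 * k : ℤ) : ℂ) * (t : ℂ) / ((1:ℝ) : ℂ)) + k * (2 * π * Complex.I) := by
    push_cast; ring
  rw [this, Complex.exp_add, Complex.exp_int_mul_two_pi_mul_I]
  ring

lemma cosSeries (a x : ℝ) (ha : 0 < a) (hx : x ∈ Ico (0:ℝ) π) :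
    HasSum (fun k : ℕ => Real.cos ((2 * k + 1) * x) / ((2 * k + 1) ^ 2 + a ^ 2))
      (π / (4 * a) * Real.sinh (a * (π / 2 - x)) / Real.cosh (a * π / 2)) := by
  have hpi := Real.pi_pos
  set b : ℝ := 2 * π * a with hb
  set g : ℝ → ℂ := fun t : ℝ => ((Real.cosh (b * (1/2 - t)) : ℝ) : ℂ) with hg
  have : Fact ((0:ℝ) < 1) := ⟨zero_lt_one⟩
  have hcont : Continuous (AddCircle.liftIco (1:ℝ) 0 g) := by
    apply AddCircle.liftIco_zero_continuous
    · simp only [hg]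
      rw [← Real.cosh_neg]; congr 2; ring
    · exact Continuous.continuousOn (by fun_prop)
  let B : C(AddCircle (1:ℝ), ℂ) := ⟨_, hcont⟩
  have hc : ∀ n : ℤ, n ≠ 0 → fourierCoeff B n =
      ((2 * b * Real.sinh (b / 2) / (4 * π ^ 2 * n ^ 2 + b ^ 2) : ℝ) : ℂ) := by
    intro n hn
    rw [← fc_aux b n hn]
    have := fourierCoeff_liftIco_eq (T := (1:ℝ)) (a := 0) g n
    rw [show (⇑B) = AddCircle.liftIco (1:ℝ) 0 g from rfl, this]
    congr 1; simp
  have hsumm : Summable (fourierCoeff B) := by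
    have h1 : Summable (fun n : ℤ => (2 * b * Real.sinh (b / 2) / (4 * π ^ 2)) * (1 / (n:ℝ) ^ 2)) :=
      (Real.summable_one_div_int_pow.mpr one_lt_two).mul_left _
    refine Summable.of_norm_bounded_eventually h1 ?_
    filter_upwards [(Set.finite_singleton (0:ℤ)).compl_mem_cofinite] with n hn0
    have hn : n ≠ 0 := hn0
    rw [hc n hn, Complex.norm_real]
    have hn' : (n : ℝ) ≠ 0 := by exact_mod_cast hn
    have hb0 : 0 < b := by positivity
    have hs : 0 < Real.sinh (b / 2) := Real.sinh_pos_iff.mpr (by positivity)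
    rw [Real.norm_of_nonneg (by positivity), div_mul_div_comm, mul_one]
    gcongr
    nlinarith [sq_nonneg b]
  have hS := has_pointwise_sum_fourier_series_of_summable hsumm
  set t : ℝ := x / (2 * π) with ht
  have ht0 : 0 ≤ t := by have := hx.1; positivity
  have ht1 : t < 1/2 := by
    rw [ht, div_lt_iff₀ (by positivity)]; linarith [hx.2]
  have h1 := (hS (t : ℝ)).sub (hS ((t + 1/2 : ℝ)))
  have v1 : B (t : ℝ) = g t := by
    have hm : t ∈ Ico (0:ℝ) (0 + 1) := ⟨by linarith, by linarith⟩
    exact AddCircle.liftIco_coe_apply (f := g) hm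
  have v2 : B ((t + 1/2 : ℝ)) = g (t + 1/2) := by
    have hm : t + 1/2 ∈ Ico (0:ℝ) (0 + 1) := ⟨by linarith, by linarith⟩
    exact AddCircle.liftIco_coe_apply (f := g) hm
  rw [v1, v2] at h1
  have h2 := h1.nat_add_neg
  have h3 : Function.Injective (fun k : ℕ => 2 * k + 1) := fun i j h => by
    simp at h; exact h
  rw [← h3.hasSum_iff] at h2
  · have hxx : Real.sinh (π * a) = 2 * Real.sinh (a * π / 2) * Real.cosh (a * π / 2) := by
      rw [← Real.sinh_two_mul]; congr 1; ring
    have hsp : 0 < Real.sinh (a * π / 2) := Real.sinh_pos_iff.mpr (by positivity)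
    have hcp := Real.cosh_pos (a * π / 2)
    have key : HasSum (fun k : ℕ => (4 * a * Real.sinh (π * a) / π) *
        (Real.cos ((2 * k + 1) * x) / ((2 * k + 1) ^ 2 + a ^ 2)))
        (2 * Real.sinh (a * π / 2) * Real.sinh (a * (π / 2 - x))) := by
      rw [← Complex.hasSum_ofReal]
      convert! h2 using 1
      · funext k
        have hodd : ((2 * k + 1 : ℕ) : ℤ) ≠ 0 := by omega
        have hodd' : (-((2 * k + 1 : ℕ) : ℤ)) ≠ 0 := by omega
        simp only [Function.comp]
        rw [hc _ hodd, hc _ hodd']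
        have o1 : ((2 * k + 1 : ℕ) : ℤ) = 2 * (k : ℤ) + 1 := by push_cast; ring
        have o2 : (-((2 * k + 1 : ℕ) : ℤ)) = 2 * (-(k : ℤ) - 1) + 1 := by push_cast; ring
        rw [o1] at *
        rw [o2]
        rw [fourier_half_odd, fourier_half_odd, fourier_coe_apply, fourier_coe_apply]
        have a1 : (2 * π * Complex.I * ((2 * (k:ℤ) + 1 : ℤ) : ℂ) * (t : ℂ) / ((1:ℝ) : ℂ)) =
            (((2 * k + 1) * x : ℝ) : ℂ) * Complex.I := by
          rw [ht]; push_cast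
          have : (π : ℂ) ≠ 0 := by exact_mod_cast hpi.ne'
          field_simp
        have a2 : (2 * π * Complex.I * ((2 * (-(k : ℤ) - 1) + 1 : ℤ) : ℂ) * (t : ℂ) / ((1:ℝ) : ℂ)) =
            -(((2 * k + 1) * x : ℝ) : ℂ) * Complex.I := by
          rw [ht]; push_cast
          have : (π : ℂ) ≠ 0 := by exact_mod_cast hpi.ne'
          field_simp
          ring
        rw [a1, a2, Complex.ofReal_mul, Complex.ofReal_div (Real.cos ((2 * k + 1) * x)),
          Complex.ofReal_cos, Complex.cos]
        have e1 : (2 * b * Real.sinh (b / 2) / (4 * π ^ 2 * ((2 * (k:ℤ) + 1 : ℤ) : ℝ) ^ 2 + b ^ 2))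
            = (a * Real.sinh (π * a) / π) / ((2 * k + 1) ^ 2 + a ^ 2) := by
          rw [show b / 2 = π * a by rw [hb]; ring, hb]
          push_cast
          field_simp
          ring
        have e2 : (2 * b * Real.sinh (b / 2) /
              (4 * π ^ 2 * ((2 * (-(k:ℤ) - 1) + 1 : ℤ) : ℝ) ^ 2 + b ^ 2))
            = (a * Real.sinh (π * a) / π) / ((2 * k + 1) ^ 2 + a ^ 2) := by
          rw [← e1]; push_cast; ring
        rw [e1, e2]
        simp only [smul_eq_mul]
        generalize Complex.exp (-(((2 * k + 1) * x : ℝ) : ℂ) * Complex.I) = E1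
        generalize Complex.exp ((((2 * k + 1) * x : ℝ) : ℂ) * Complex.I) = E2
        push_cast
        ring
      · have z0 := fourier_half_even 0 t
        rw [mul_zero] at z0
        rw [z0, sub_self, add_zero, hg]
        rw [← Complex.ofReal_sub]
        congr 1
        have c1 : b * (1 / 2 - t) = a * π / 2 + a * (π / 2 - x) := by
          rw [hb, ht]; field_simp; ring
        have c2 : b * (1 / 2 - (t + 1 / 2)) = -(a * π / 2 - a * (π / 2 - x)) := by
          rw [hb, ht]; field_simp; ring
        rw [c1, c2, Real.cosh_neg, Real.cosh_add, Real.cosh_sub]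
        ring
    have h5 := key.mul_left (π / (4 * a * Real.sinh (π * a)))
    convert! h5 using 1
    · funext k
      rw [hxx]; field_simp
    · rw [hxx]; field_simp
  · intro n hn
    have he : Even n := by
      rcases Nat.even_or_odd n with h | ⟨k, hk⟩
      · exact h
      · exact absurd ⟨k, hk.symm⟩ hn
    obtain ⟨r, rfl⟩ := he
    have o1 : ((r + r : ℕ) : ℤ) = 2 * (r : ℤ) := by push_cast; ring
    have o2 : (-((r + r : ℕ) : ℤ)) = 2 * (-(r : ℤ)) := by push_cast; ring
    rw [o2, o1, fourier_half_even, fourier_half_even]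
    ring

lemma sinSeries (a x : ℝ) (ha : 0 < a) (hx : x ∈ Ioo (0:ℝ) π) :
    HasSum (fun k : ℕ => Real.sin ((2 * k + 1) * x) / ((2 * k + 1) * ((2 * k + 1) ^ 2 + a ^ 2)))
      (π / (4 * a ^ 2) * (1 - Real.cosh (a * (π / 2 - x)) / Real.cosh (a * π / 2))) := by
  have hcp := Real.cosh_pos (a * π / 2)
  have hsum : Summable (fun k : ℕ => (1 : ℝ) / ((2 * k + 1) ^ 2 + a ^ 2)) := by
    have h1 := (cosSeries a 0 ha ⟨le_rfl, Real.pi_pos⟩).summable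
    simpa using h1
  have key := intervalIntegral.hasSum_integral_of_dominated_convergence
    (μ := MeasureTheory.volume) (a := 0) (b := x)
    (F := fun (k : ℕ) (t : ℝ) => Real.cos ((2 * k + 1) * t) / ((2 * k + 1) ^ 2 + a ^ 2))
    (f := fun t => π / (4 * a) * Real.sinh (a * (π / 2 - t)) / Real.cosh (a * π / 2))
    (fun (k : ℕ) (_ : ℝ) => (1 : ℝ) / ((2 * k + 1) ^ 2 + a ^ 2))
    (fun k => Continuous.aestronglyMeasurable (by fun_prop))
    (fun k => Eventually.of_forall fun t _ => by
      rw [norm_div, Real.norm_eq_abs, Real.norm_of_nonneg (by positivity)]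
      gcongr
      exact Real.abs_cos_le_one _)
    (Eventually.of_forall fun t _ => hsum)
    (by simp)
    (Eventually.of_forall fun t ht => by
      rw [uIoc_of_le hx.1.le] at ht
      exact cosSeries a t ha ⟨ht.1.le, ht.2.trans_lt hx.2⟩)
  convert! key using 1
  · funext k
    have : ∀ t ∈ uIcc 0 x, HasDerivAt
        (fun t : ℝ => Real.sin ((2 * k + 1) * t) / ((2 * k + 1) * ((2 * k + 1) ^ 2 + a ^ 2)))
        (Real.cos ((2 * k + 1) * t) / ((2 * k + 1) ^ 2 + a ^ 2)) t := by
      intro t _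
      have h1 : HasDerivAt (fun t : ℝ => (2 * (k:ℝ) + 1) * t) ((2 * k + 1) * 1) t :=
        (hasDerivAt_id t).const_mul _
      convert! (h1.sin.div_const ((2 * k + 1) * ((2 * k + 1) ^ 2 + a ^ 2))) using 1
      field_simp
    rw [intervalIntegral.integral_eq_sub_of_hasDerivAt this
      (Continuous.intervalIntegrable (by fun_prop) _ _)]
    simp
  · have : ∀ t ∈ uIcc 0 x, HasDerivAt
        (fun t : ℝ => - (π / (4 * a ^ 2)) * Real.cosh (a * (π / 2 - t)) / Real.cosh (a * π / 2))
        (π / (4 * a) * Real.sinh (a * (π / 2 - t)) / Real.cosh (a * π / 2)) t := by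
      intro t _
      have h1 : HasDerivAt (fun t : ℝ => a * (π / 2 - t)) (a * (-1)) t :=
        ((hasDerivAt_id t).const_sub (π / 2)).const_mul a
      convert! ((h1.cosh.const_mul (- (π / (4 * a ^ 2)))).div_const (Real.cosh (a * π / 2))) using 1
      field_simp
    rw [intervalIntegral.integral_eq_sub_of_hasDerivAt this
      (Continuous.intervalIntegrable (by fun_prop) _ _)]
    rw [show a * (π / 2 - 0) = a * π / 2 by ring]
    field_simp
    ring

lemma dirichlet_cos (K : ℕ) (t : ℝ) :
    2 * Real.sin t * ∑ k ∈ Finset.range K, Real.cos ((2 * k + 1) * t) = Real.sin (2 * K * t) := by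
  induction K with
  | zero => simp
  | succ K ih =>
    rw [Finset.sum_range_succ, mul_add, ih]
    push_cast
    rw [show 2 * ((K:ℝ) + 1) * t = (2 * K + 1) * t + t by ring,
      show 2 * (K:ℝ) * t = (2 * K + 1) * t - t by ring, Real.sin_add, Real.sin_sub]
    ring

lemma dirichlet_sin (K : ℕ) (t : ℝ) :
    Real.sin t * ∑ k ∈ Finset.range K, Real.sin ((2 * k + 1) * t) = Real.sin (K * t) ^ 2 := by
  induction K with
  | zero => simp
  | succ K ih =>
    rw [Finset.sum_range_succ, mul_add, ih]
    push_cast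
    rw [show ((K:ℝ) + 1) * t = K * t + t by ring,
      show (2 * (K:ℝ) + 1) * t = (2 * (K * t)) + t by ring, Real.sin_add, Real.sin_add,
      Real.sin_two_mul, Real.cos_two_mul]
    have h1 := Real.sin_sq_add_cos_sq t
    have h2 := Real.sin_sq_add_cos_sq (K * t)
    generalize Real.sin (K * t) = S at *
    generalize Real.cos (K * t) = C at *
    generalize Real.sin t = s at *
    generalize Real.cos t = c at *
    have h3 : C ^ 2 = 1 - S ^ 2 := by linarith
    have h4 : c ^ 2 = 1 - s ^ 2 := by linarith
    linear_combination (s ^ 2) * h3 - S ^ 2 * h4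

lemma squareWave (x : ℝ) (hx : x ∈ Ioo (0:ℝ) π) :
    Tendsto (fun K : ℕ => ∑ k ∈ Finset.range K, Real.sin ((2 * k + 1) * x) / (2 * k + 1)) atTop
      (𝓝 (π / 4)) := by
  set S : ℕ → ℝ → ℝ := fun K x => ∑ k ∈ Finset.range K, Real.sin ((2 * k + 1) * x) / (2 * k + 1)
    with hS
  have hleib : Tendsto (fun K => S K (π / 2)) atTop (𝓝 (π / 4)) := by
    convert! Real.tendsto_sum_pi_div_four using 1
    funext K
    refine Finset.sum_congr rfl fun k _ => ?_
    rw [show (2 * (k:ℝ) + 1) * (π / 2) = k * π + π / 2 by ring, Real.sin_add_pi_div_two,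
      Real.cos_nat_mul_pi]
  have hm : 0 < Real.sin x := Real.sin_pos_of_mem_Ioo hx
  set m := Real.sin x with hmdef
  set r := |x - π / 2| with hr
  have hr2 : r < π / 2 := by
    rw [hr, abs_lt]; constructor <;> linarith [hx.1, hx.2]
  have hlow : ∀ t ∈ Metric.closedBall (π / 2) r, m ≤ Real.sin t := by
    intro t ht
    rw [Metric.mem_closedBall, Real.dist_eq] at ht
    have e1 : Real.sin t = Real.cos |t - π / 2| := by
      rw [Real.cos_abs, Real.cos_sub_pi_div_two]
    have e2 : m = Real.cos r := by
      rw [hr, Real.cos_abs, Real.cos_sub_pi_div_two]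
    rw [e1, e2]
    exact Real.cos_le_cos_of_nonneg_of_le_pi (abs_nonneg _) (by linarith [Real.pi_pos]) ht
  have hbound : ∀ K : ℕ, 0 < K → |S K x - S K (π / 2)| ≤ (r / (4 * m ^ 2) + 1 / (2 * m)) * (1 / K) := by
    intro K hK
    have hK' : (0:ℝ) < K := by exact_mod_cast hK
    set P : ℝ → ℝ := fun t => S K t + Real.cos (2 * K * t) / (4 * K * Real.sin t) with hP
    have hd : ∀ t ∈ Metric.closedBall (π / 2) r, HasDerivWithinAt P
        (- (Real.cos (2 * K * t) * Real.cos t / (4 * K * Real.sin t ^ 2)))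
        (Metric.closedBall (π / 2) r) t := by
      intro t ht
      have hs : 0 < Real.sin t := hm.trans_le (hlow t ht)
      apply HasDerivAt.hasDerivWithinAt
      have h1 : HasDerivAt (S K) (∑ k ∈ Finset.range K, Real.cos ((2 * k + 1) * t)) t := by
        apply HasDerivAt.fun_sum
        intro k _
        have h1 : HasDerivAt (fun t : ℝ => (2 * (k:ℝ) + 1) * t) ((2 * k + 1) * 1) t :=
          (hasDerivAt_id t).const_mul _
        convert! (h1.sin.div_const (2 * (k:ℝ) + 1)) using 1
        field_simp
      have h2 : HasDerivAt (fun t : ℝ => 2 * (K:ℝ) * t) (2 * K * 1) t :=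
        (hasDerivAt_id t).const_mul _
      have h3 := h1.add (h2.cos.div ((Real.hasDerivAt_sin t).const_mul (4 * (K:ℝ))) (by positivity))
      convert! h3 using 1
      have h4 := dirichlet_cos K t
      have h5 : ∑ k ∈ Finset.range K, Real.cos ((2 * k + 1) * t) =
          Real.sin (2 * K * t) / (2 * Real.sin t) := by
        rw [← h4, mul_div_cancel_left₀ _ (by positivity)]
      rw [h5]
      field_simp
      ring
    have hb : ∀ t ∈ Metric.closedBall (π / 2) r,
        ‖- (Real.cos (2 * K * t) * Real.cos t / (4 * K * Real.sin t ^ 2))‖ ≤ 1 / (4 * K * m ^ 2) := by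
      intro t ht
      have hs := hlow t ht
      rw [norm_neg, norm_div, norm_mul, Real.norm_eq_abs, Real.norm_eq_abs,
        Real.norm_of_nonneg (by positivity)]
      gcongr
      exact mul_le_one₀ (Real.abs_cos_le_one _) (abs_nonneg _) (Real.abs_cos_le_one _)
    have hmv := (convex_closedBall (π / 2) r).norm_image_sub_le_of_norm_hasDerivWithin_le hd hb
      (Metric.mem_closedBall_self (abs_nonneg _))
      (show x ∈ Metric.closedBall (π / 2) r by rw [Metric.mem_closedBall, Real.dist_eq])
    rw [Real.norm_eq_abs, Real.norm_eq_abs, ← hr] at hmv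
    have c1 : |Real.cos (2 * K * x) / (4 * K * Real.sin x)| ≤ 1 / (4 * K * m) := by
      rw [abs_div, abs_of_pos (show 0 < 4 * K * Real.sin x by positivity)]
      gcongr
      exact Real.abs_cos_le_one _
    have c2 : |Real.cos (2 * K * (π / 2)) / (4 * K * Real.sin (π / 2))| ≤ 1 / (4 * K * m) := by
      rw [abs_div, Real.sin_pi_div_two, abs_of_pos (show 0 < 4 * (K:ℝ) * 1 by positivity)]
      gcongr
      · exact Real.abs_cos_le_one _
      · exact Real.sin_le_one x
    have e : S K x - S K (π / 2) = (P x - P (π / 2)) - Real.cos (2 * K * x) / (4 * K * Real.sin x)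
        + Real.cos (2 * K * (π / 2)) / (4 * K * Real.sin (π / 2)) := by
      simp only [hP]; ring
    rw [e]
    have tri := abs_add_le ((P x - P (π / 2)) - Real.cos (2 * K * x) / (4 * K * Real.sin x))
      (Real.cos (2 * K * (π / 2)) / (4 * K * Real.sin (π / 2)))
    have tri2 := abs_sub (P x - P (π / 2)) (Real.cos (2 * K * x) / (4 * K * Real.sin x))
    have fin : (r / (4 * m ^ 2) + 1 / (2 * m)) * (1 / K) =
        1 / (4 * K * m ^ 2) * r + 1 / (4 * K * m) + 1 / (4 * K * m) := by
      field_simp; ring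
    rw [fin]
    linarith
  have hz : Tendsto (fun K => S K x - S K (π / 2)) atTop (𝓝 0) := by
    apply squeeze_zero_norm' (a := fun K : ℕ => (r / (4 * m ^ 2) + 1 / (2 * m)) * (1 / (K:ℝ)))
    · filter_upwards [eventually_gt_atTop 0] with K hK
      exact hbound K hK
    · have := (tendsto_one_div_atTop_nhds_zero_nat (𝕜 := ℝ)).const_mul (r / (4 * m ^ 2) + 1 / (2 * m))
      simpa using this
  have := hz.add hleib
  simpa using this

lemma kernel_bound (x : ℝ) (hx : x ∈ Ioo (0:ℝ) π) :
    ∃ C : ℝ, 0 ≤ C ∧ ∀ n : ℝ, 1 ≤ n → ∀ K : ℕ,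
      |∑ k ∈ Finset.range K, Real.sin ((2 * k + 1) * x) *
        ((2 * k + 1) / ((2 * k + 1) ^ 2 + n ^ 2))| ≤ C / Real.sqrt n := by
  have hm : 0 < Real.sin x := Real.sin_pos_of_mem_Ioo hx
  set A := 1 / Real.sin x with hA
  have hA0 : 0 < A := by positivity
  set D : ℕ → ℝ := fun K => ∑ k ∈ Finset.range K, Real.sin ((2 * k + 1) * x) with hD
  have hDb : ∀ K, |D K| ≤ A := by
    intro K
    have h1 : D K = Real.sin (K * x) ^ 2 / Real.sin x := by
      rw [← dirichlet_sin, mul_div_cancel_left₀ _ hm.ne']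
    rw [h1, abs_div, abs_of_pos hm, hA]
    gcongr
    rw [abs_of_nonneg (sq_nonneg _)]
    exact Real.sin_sq_le_one _
  have hsum : Summable (fun k : ℕ => 2 / ((2 * k + 1) * Real.sqrt (2 * k + 1)) : ℕ → ℝ) := by
    have h1 : Summable (fun k : ℕ => 2 * (1 / ((k + 1 : ℕ) : ℝ) ^ (3 / 2 : ℝ))) :=
      ((summable_nat_add_iff 1).mpr
        (Real.summable_one_div_nat_rpow.mpr (by norm_num : (1:ℝ) < 3 / 2))).mul_left 2
    refine Summable.of_nonneg_of_le (fun k => by positivity) (fun k => ?_) h1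
    have hk : (0:ℝ) < ((k + 1 : ℕ) : ℝ) := by positivity
    rw [show (3 / 2 : ℝ) = 1 + 1 / 2 by norm_num, Real.rpow_add hk, Real.rpow_one,
      ← Real.sqrt_eq_rpow, mul_one_div]
    push_cast
    gcongr <;> linarith [(Nat.cast_nonneg k : (0:ℝ) ≤ k)]
  set Z := ∑' k : ℕ, (2 / ((2 * k + 1) * Real.sqrt (2 * k + 1)) : ℝ) with hZ
  have hZ0 : 0 ≤ Z := tsum_nonneg fun k => by positivity
  refine ⟨A * (1 + Z), by positivity, ?_⟩
  intro n hn K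
  have hn0 : 0 < n := by linarith
  set f : ℕ → ℝ := fun k => (2 * k + 1) / ((2 * k + 1) ^ 2 + n ^ 2) with hf
  have parts : ∀ K, ∑ k ∈ Finset.range K, Real.sin ((2 * k + 1) * x) * f k =
      D K * f K - ∑ k ∈ Finset.range K, D (k + 1) * (f (k + 1) - f k) := by
    intro K
    induction K with
    | zero => simp [hD]
    | succ K ih =>
      rw [Finset.sum_range_succ, Finset.sum_range_succ, ih]
      have : D (K + 1) = D K + Real.sin ((2 * K + 1) * x) := by
        simp only [hD, Finset.sum_range_succ]
      rw [this]; ring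
  have hsn : 0 < Real.sqrt n := Real.sqrt_pos.mpr hn0
  have hfb : ∀ k, |f k| ≤ 1 / Real.sqrt n := by
    intro k
    simp only [hf]
    rw [abs_of_pos (by positivity), div_le_div_iff₀ (by positivity) hsn]
    have h1 : Real.sqrt n ≤ n := by
      rw [Real.sqrt_le_left hn0.le]; nlinarith
    have hm1 : (0:ℝ) < 2 * k + 1 := by positivity
    nlinarith [mul_le_mul_of_nonneg_left h1 hm1.le, sq_nonneg ((2 * (k:ℝ) + 1) - n)]
  have hdf : ∀ k, |f (k + 1) - f k| ≤
      (2 / ((2 * k + 1) * Real.sqrt (2 * k + 1))) * (1 / Real.sqrt n) := by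
    intro k
    simp only [hf]
    have hm1 : (0:ℝ) < 2 * k + 1 := by positivity
    push_cast
    rw [show 2 * ((k:ℝ) + 1) + 1 = (2 * k + 1) + 2 by ring]
    generalize (2 * (k:ℝ) + 1) = m at *
    have hsm : 0 < Real.sqrt m := Real.sqrt_pos.mpr hm1
    have e1 : |(m + 2) / ((m + 2) ^ 2 + n ^ 2) - m / (m ^ 2 + n ^ 2)| ≤ 2 / (m ^ 2 + n ^ 2) := by
      have e : (m + 2) / ((m + 2) ^ 2 + n ^ 2) - m / (m ^ 2 + n ^ 2) =
          ((n ^ 2 - m * (m + 2)) / ((m + 2) ^ 2 + n ^ 2)) * (2 / (m ^ 2 + n ^ 2)) := by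
        field_simp; ring
      rw [e, abs_mul, abs_of_pos (show 0 < 2 / (m ^ 2 + n ^ 2) by positivity)]
      apply mul_le_of_le_one_left (by positivity)
      rw [abs_div, abs_of_pos (show 0 < (m + 2) ^ 2 + n ^ 2 by positivity),
        div_le_one (by positivity), abs_le]
      constructor <;> nlinarith [sq_nonneg n, sq_nonneg m]
    refine e1.trans ?_
    rw [div_mul_div_comm, mul_one]
    gcongr
    have q1 := Real.sq_sqrt hm1.le
    have q2 := Real.sq_sqrt hn0.le
    generalize Real.sqrt m = p at *
    generalize Real.sqrt n = q at *
    rw [← q1, ← q2]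
    rcases le_total p q with hpq | hpq
    · have : p ^ 3 * q ≤ q ^ 3 * q := by gcongr
      nlinarith [sq_nonneg (p ^ 2)]
    · have : p ^ 3 * q ≤ p ^ 3 * p := by gcongr
      nlinarith [sq_nonneg (q ^ 2)]
  change |∑ k ∈ Finset.range K, Real.sin ((2 * k + 1) * x) * f k| ≤ _
  rw [parts]
  have b1 : |D K * f K| ≤ A * (1 / Real.sqrt n) := by
    rw [abs_mul]
    exact mul_le_mul (hDb K) (hfb K) (abs_nonneg _) hA0.le
  have b2 : |∑ k ∈ Finset.range K, D (k + 1) * (f (k + 1) - f k)| ≤ A * Z * (1 / Real.sqrt n) := by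
    calc |∑ k ∈ Finset.range K, D (k + 1) * (f (k + 1) - f k)|
        ≤ ∑ k ∈ Finset.range K, |D (k + 1) * (f (k + 1) - f k)| := Finset.abs_sum_le_sum_abs _ _
      _ ≤ ∑ k ∈ Finset.range K,
          A * ((2 / ((2 * k + 1) * Real.sqrt (2 * k + 1))) * (1 / Real.sqrt n)) := by
        refine Finset.sum_le_sum fun k _ => ?_
        rw [abs_mul]
        exact mul_le_mul (hDb _) (hdf k) (abs_nonneg _) hA0.le
      _ = A * (∑ k ∈ Finset.range K, (2 / ((2 * k + 1) * Real.sqrt (2 * k + 1)) : ℝ))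
          * (1 / Real.sqrt n) := by
        rw [← Finset.mul_sum, ← Finset.sum_mul]; ring
      _ ≤ A * Z * (1 / Real.sqrt n) := by
        gcongr
        exact hsum.sum_le_tsum _ fun k _ => by positivity
  have := abs_sub (D K * f K) (∑ k ∈ Finset.range K, D (k + 1) * (f (k + 1) - f k))
  calc _ ≤ _ := this
    _ ≤ A * (1 / Real.sqrt n) + A * Z * (1 / Real.sqrt n) := add_le_add b1 b2
    _ = _ := by ring

/-- The profile `cosh (n (π/2 - y)) / cosh (n π / 2)`. -/
noncomputable def prof (n y : ℝ) : ℝ := Real.cosh (n * (π / 2 - y)) / Real.cosh (n * π / 2)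

lemma profile_eq (n y : ℝ) (hn : 0 < n) : F n y - coth (n * π) * G n y = prof n y := by
  have hs : 0 < Real.sinh (n * π / 2) := Real.sinh_pos_iff.mpr (by positivity)
  have hc := Real.cosh_pos (n * π / 2)
  have e1 : n * y = n * π / 2 - n * (π / 2 - y) := by ring
  have e2 : n * (π - y) = n * π / 2 + n * (π / 2 - y) := by ring
  have e3 : n * π = 2 * (n * π / 2) := by ring
  have hsq := Real.cosh_sq (n * π / 2)
  rw [F, G, coth, prof, e1, e2, e3, Real.sinh_two_mul, Real.cosh_two_mul, ← e3]
  rw [Real.cosh_sub, Real.cosh_add, Real.sinh_sub, Real.sinh_add]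
  generalize Real.sinh (n * π / 2) = S at *
  generalize Real.cosh (n * π / 2) = C at *
  generalize Real.sinh (n * (π / 2 - y)) = s
  generalize Real.cosh (n * (π / 2 - y)) = c
  field_simp
  linear_combination (2 * S * c) * hsq

lemma kernel_tendsto (x n : ℝ) (hx : x ∈ Ioo (0:ℝ) π) (hn : 0 < n) :
    Tendsto (fun K : ℕ => ∑ k ∈ Finset.range K, Real.sin ((2 * k + 1) * x) *
        ((2 * k + 1) / ((2 * k + 1) ^ 2 + n ^ 2))) atTop (𝓝 (π / 4 * prof n x)) := by
  have h1 := squareWave x hx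
  have h2 := ((sinSeries n x hn hx).mul_left (n ^ 2)).tendsto_sum_nat
  convert! h1.sub h2 using 1
  · funext K
    rw [← Finset.sum_sub_distrib]
    refine Finset.sum_congr rfl fun k _ => ?_
    field_simp
    ring
  · rw [prof]
    congr 1
    field_simp
    ring

lemma h_eq (x y : ℝ) : h x y = (4 / π) * ∑' k : ℕ, (Real.sin ((2 * k + 1) * x) / (2 * k + 1)) *
    prof (2 * k + 1) y := by
  rw [h]
  congr 1
  refine tsum_congr fun k => ?_
  rw [profile_eq _ _ (by positivity)]

lemma summable_dom (C : ℝ) (hC : 0 ≤ C) :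
    Summable (fun k : ℕ => (1 / (2 * k + 1)) * (C / Real.sqrt (2 * k + 1)) : ℕ → ℝ) := by
  have h1 : Summable (fun k : ℕ => C * (1 / ((k + 1 : ℕ) : ℝ) ^ (3 / 2 : ℝ))) :=
    ((summable_nat_add_iff 1).mpr
      (Real.summable_one_div_nat_rpow.mpr (by norm_num : (1:ℝ) < 3 / 2))).mul_left C
  refine Summable.of_nonneg_of_le (fun k => by positivity) (fun k => ?_) h1
  have hk : (0:ℝ) < ((k + 1 : ℕ) : ℝ) := by positivity
  rw [show (3 / 2 : ℝ) = 1 + 1 / 2 by norm_num, Real.rpow_add hk, Real.rpow_one,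
    ← Real.sqrt_eq_rpow, mul_one_div, div_mul_div_comm, one_mul]
  push_cast
  gcongr <;> linarith [(Nat.cast_nonneg k : (0:ℝ) ≤ k)]

lemma summable_h (x y : ℝ) (hy : y ∈ Ioo (0:ℝ) π) :
    Summable (fun k : ℕ => (Real.sin ((2 * k + 1) * x) / (2 * k + 1)) * prof (2 * k + 1) y) := by
  obtain ⟨C, hC, hb⟩ := kernel_bound y hy
  refine Summable.of_norm_bounded (g := fun k : ℕ =>
    (1 / (2 * k + 1)) * ((4 / π * C) / Real.sqrt (2 * k + 1)))
    (summable_dom (4 / π * C) (by positivity)) fun k => ?_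
  have hk : (1:ℝ) ≤ 2 * k + 1 := by linarith [(Nat.cast_nonneg k : (0:ℝ) ≤ k)]
  have h1 := le_of_tendsto (kernel_tendsto y (2 * k + 1) hy (by positivity)).abs
    (Eventually.of_forall (hb (2 * k + 1) hk))
  rw [norm_mul, norm_div, Real.norm_eq_abs, Real.norm_eq_abs, Real.norm_eq_abs,
    abs_of_pos (show (0:ℝ) < 2 * k + 1 by positivity)]
  rw [abs_mul, abs_of_pos (show 0 < π / 4 by positivity)] at h1
  have h2 : |prof (2 * k + 1) y| ≤ (4 / π * C) / Real.sqrt (2 * k + 1) := by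
    calc |prof (2 * k + 1) y| = 4 / π * (π / 4 * |prof (2 * k + 1) y|) := by field_simp
      _ ≤ 4 / π * (C / Real.sqrt (2 * k + 1)) := by gcongr
      _ = _ := by ring
  gcongr
  exact Real.abs_sin_le_one _

lemma h_symm (x y : ℝ) (hx : x ∈ Ioo (0:ℝ) π) (hy : y ∈ Ioo (0:ℝ) π) : h x y + h y x = 1 := by
  have hpi := Real.pi_pos
  set T : ℕ → ℝ := fun M => ∑ k ∈ Finset.range M,
    (Real.sin ((2 * k + 1) * x) / (2 * k + 1)) * (1 - prof (2 * k + 1) y) with hT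
  have lim1 : Tendsto T atTop (𝓝 (π / 4 - π / 4 * h x y)) := by
    have h1 := (squareWave x hx).sub (summable_h x y hy).hasSum.tendsto_sum_nat
    convert! h1 using 1
    · funext M
      rw [← Finset.sum_sub_distrib]
      exact Finset.sum_congr rfl fun k _ => by ring
    · rw [h_eq, ← mul_assoc, show π / 4 * (4 / π) = 1 by field_simp, one_mul]
  obtain ⟨C, hC, hb⟩ := kernel_bound x hx
  have lim2 : Tendsto T atTop (𝓝 (π / 4 * h y x)) := by
    have key := tendsto_tsum_of_dominated_convergence (𝓕 := atTop)
      (f := fun (M : ℕ) (j : ℕ) => (Real.sin ((2 * j + 1) * y) / (2 * j + 1)) *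
        ∑ k ∈ Finset.range M, Real.sin ((2 * k + 1) * x) *
          ((2 * k + 1) / ((2 * k + 1) ^ 2 + (2 * (j:ℝ) + 1) ^ 2)))
      (g := fun j : ℕ => (Real.sin ((2 * j + 1) * y) / (2 * j + 1)) * (π / 4 * prof (2 * j + 1) x))
      (summable_dom C hC)
      (fun j => (kernel_tendsto x (2 * j + 1) hx (by positivity)).const_mul _)
      (Eventually.of_forall fun M j => by
        have hk : (1:ℝ) ≤ 2 * j + 1 := by linarith [(Nat.cast_nonneg j : (0:ℝ) ≤ j)]
        rw [norm_mul, norm_div, Real.norm_eq_abs, Real.norm_eq_abs, Real.norm_eq_abs,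
          abs_of_pos (show (0:ℝ) < 2 * j + 1 by positivity)]
        have := hb (2 * j + 1) hk M
        gcongr
        exact Real.abs_sin_le_one _)
    convert! key.const_mul (4 / π) using 1
    · funext M
      have hs : ∀ k ∈ Finset.range M, HasSum (fun j : ℕ =>
          (4 / π) * ((Real.sin ((2 * j + 1) * y) / (2 * j + 1)) * (Real.sin ((2 * k + 1) * x) *
          ((2 * k + 1) / ((2 * k + 1) ^ 2 + (2 * (j:ℝ) + 1) ^ 2)))))
          ((Real.sin ((2 * k + 1) * x) / (2 * k + 1)) * (1 - prof (2 * k + 1) y)) := by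
        intro k _
        have h1 := (sinSeries (2 * k + 1) y (by positivity) hy).mul_left
          (4 / π * (Real.sin ((2 * k + 1) * x) * (2 * k + 1)))
        convert! h1 using 1
        · funext j
          rw [add_comm ((2 * (k:ℝ) + 1) ^ 2)]
          field_simp
        · rw [prof]
          field_simp
      have h2 := (hasSum_sum hs).tsum_eq
      simp only [hT]
      rw [← h2, ← tsum_mul_left]
      refine tsum_congr fun j => ?_
      rw [Finset.mul_sum, Finset.mul_sum]
    · rw [h_eq, ← tsum_mul_left, ← tsum_mul_left, ← tsum_mul_left]
      congr 1
      refine tsum_congr fun j => ?_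
      field_simp
  have := tendsto_nhds_unique lim1 lim2
  have h3 : π / 4 * (h x y + h y x) = π / 4 * 1 := by linarith
  exact mul_left_cancel₀ (by positivity) h3

theorem stmt12 :
    (∀ x ∈ Set.Ioo (0:ℝ) π, ∀ y ∈ Set.Ioo (0:ℝ) π, h x y + h y x = 1) ∧
    h (π / 4) (π / 4) = 1 / 2 := by
  refine ⟨fun x hx y hy => h_symm x y hx hy, ?_⟩
  have hm : π / 4 ∈ Ioo (0:ℝ) π := ⟨by positivity, by linarith [Real.pi_pos]⟩
  have := h_symm _ _ hm hm
  linarith
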